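/- Let R be a primal commutative ring having Property (A) and let B be a content R-algebra. Then B is primal, B has Property (A), and Z(B) = Z(R)B. -/

import Mathlib

/-- The content `c(f)` of an element `f` of a commutative `R`-algebra `B`: the
intersection of all ideals `I` of `R` with `f ∈ IB`. -/
def contentIdeal (R : Type*) {B : Type*} [CommRing R] [CommRing B] [Algebra R B]
    (f : B) : Ideal R :=
  sInf {I : Ideal R | f ∈ I • (⊤ : Submodule R B)}

/-- `B` is a content `R`-algebra: (i) `f ∈ c(f)B` for all `f`; (ii) `c(rf) = r·c(f)`
and the ideal generated by all the contents is `R`; (iii) the Dedekind–Mertens content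
formula holds. -/
structure IsContentAlgebra (R B : Type*) [CommRing R] [CommRing B] [Algebra R B] : Prop where
  mem_content_smul : ∀ f : B, f ∈ contentIdeal R f • (⊤ : Submodule R B)
  content_smul : ∀ (r : R) (f : B),
    contentIdeal R (algebraMap R B r * f) = Ideal.span {r} * contentIdeal R f
  content_top : (⨆ f : B, contentIdeal R f) = ⊤
  dedekind_mertens : ∀ f g : B, ∃ n : ℕ, 1 ≤ n ∧
    contentIdeal R f ^ n * contentIdeal R g =
      contentIdeal R f ^ (n - 1) * contentIdeal R (f * g)

/-- The set of zero-divisors of `R`. -/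
def zdSet (R : Type*) [CommRing R] : Set R := {r : R | ∃ s : R, s ≠ 0 ∧ r * s = 0}

/-- `R` has Property (A): every finitely generated ideal consisting of zero-divisors has
a nonzero annihilator. -/
def PropertyA (R : Type*) [CommRing R] : Prop :=
  ∀ I : Ideal R, I.FG → (I : Set R) ⊆ zdSet R → ∃ r : R, r ≠ 0 ∧ ∀ x ∈ I, r * x = 0

/-- `R` is a primal ring: its set of zero-divisors is an ideal. -/
def PrimalRing (R : Type*) [CommRing R] : Prop :=
  ∃ I : Ideal R, (I : Set R) = zdSet R

/-- Every element of `IM` already lies in `JM` for a finitely generated ideal `J ≤ I`. -/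
theorem exists_fg_le_mem_smul_top {R M : Type*} [CommRing R] [AddCommGroup M] [Module R M]
    {I : Ideal R} {x : M} (hx : x ∈ I • (⊤ : Submodule R M)) :
    ∃ J : Ideal R, J.FG ∧ J ≤ I ∧ x ∈ J • (⊤ : Submodule R M) := by
  induction hx using Submodule.smul_induction_on' with
  | smul r hr m _ =>
    exact ⟨Ideal.span {r}, Submodule.fg_span_singleton r,
      (Ideal.span_singleton_le_iff_mem I).2 hr,
      Submodule.smul_mem_smul (Ideal.mem_span_singleton_self r) trivial⟩
  | add x _ y _ hx hy =>
    obtain ⟨J, hJ, hJI, hxJ⟩ := hx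
    obtain ⟨K, hK, hKI, hyK⟩ := hy
    exact ⟨J ⊔ K, Submodule.FG.sup hJ hK, sup_le hJI hKI,
      add_mem (Submodule.smul_mono_left le_sup_left hxJ)
        (Submodule.smul_mono_left le_sup_right hyK)⟩

section Content

variable {R B : Type*} [CommRing R] [CommRing B] [Algebra R B]

theorem contentIdeal_le {I : Ideal R} {f : B} (hf : f ∈ I • (⊤ : Submodule R B)) :
    contentIdeal R f ≤ I :=
  sInf_le hf

theorem contentIdeal_zero : contentIdeal R (0 : B) = ⊥ :=
  le_bot_iff.1 (contentIdeal_le (zero_mem _))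

namespace IsContentAlgebra

theorem contentIdeal_fg (hB : IsContentAlgebra R B) (f : B) : (contentIdeal R f).FG := by
  obtain ⟨J, hJ, hle, hf⟩ := exists_fg_le_mem_smul_top (hB.mem_content_smul f)
  exact le_antisymm (contentIdeal_le hf) hle ▸ hJ

theorem contentIdeal_eq_bot_iff (hB : IsContentAlgebra R B) {f : B} :
    contentIdeal R f = ⊥ ↔ f = 0 := by
  refine ⟨fun h => ?_, fun h => h ▸ contentIdeal_zero⟩
  simpa [h] using hB.mem_content_smul f

theorem algebraMap_ne_zero (hB : IsContentAlgebra R B) {r : R} (hr : r ≠ 0) :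
    algebraMap R B r ≠ 0 := by
  intro h
  have hle : (⨆ f : B, contentIdeal R f) ≤ (Ideal.span {r}).annihilator := by
    refine iSup_le fun f => ?_
    rw [Submodule.le_annihilator_iff, smul_eq_mul, mul_comm, ← hB.content_smul, h, zero_mul,
      contentIdeal_zero]
  rw [hB.content_top] at hle
  have h1 := Submodule.mem_annihilator.1 (hle (Submodule.mem_top (x := (1 : R)))) r
    (Ideal.mem_span_singleton_self r)
  exact hr (by simpa using h1)

theorem algebraMap_mul_eq_zero (hB : IsContentAlgebra R B) {r : R} {f : B}
    (h : ∀ x ∈ contentIdeal R f, r * x = 0) :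
    algebraMap R B r * f = 0 := by
  rw [← hB.contentIdeal_eq_bot_iff, hB.content_smul, ← le_bot_iff,
    Ideal.span_singleton_mul_le_iff]
  exact h

/-- The content of a zero-divisor has a nonzero annihilator (McCoy's theorem). -/
theorem exists_ne_zero_mul_contentIdeal (hB : IsContentAlgebra R B) {f : B} (hf : f ∈ zdSet B) :
    ∃ r : R, r ≠ 0 ∧ ∀ x ∈ contentIdeal R f, r * x = 0 := by
  classical
  obtain ⟨g, hg, hfg⟩ := hf
  have hex : ∃ n : ℕ, contentIdeal R f ^ n * contentIdeal R g = ⊥ := by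
    obtain ⟨n, -, hn⟩ := hB.dedekind_mertens f g
    exact ⟨n, by rw [hn, hfg, contentIdeal_zero, Ideal.mul_bot]⟩
  have hspec := Nat.find_spec hex
  rcases hn : Nat.find hex with _ | m
  · rw [hn, pow_zero, Ideal.one_eq_top, Ideal.top_mul, hB.contentIdeal_eq_bot_iff] at hspec
    exact (hg hspec).elim
  · have hmin := Nat.find_min hex (m := m) (by omega)
    obtain ⟨r, hr, hr0⟩ := Submodule.exists_mem_ne_zero_of_ne_bot hmin
    refine ⟨r, hr0, fun x hx => ?_⟩
    have hmem := Ideal.mul_mem_mul hr hx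
    rwa [mul_right_comm, ← pow_succ, ← hn, hspec, Ideal.mem_bot] at hmem

theorem contentIdeal_subset_zdSet (hB : IsContentAlgebra R B) {f : B} (hf : f ∈ zdSet B) :
    (contentIdeal R f : Set R) ⊆ zdSet R := by
  obtain ⟨r, hr, h⟩ := hB.exists_ne_zero_mul_contentIdeal hf
  exact fun x hx => ⟨r, hr, by rw [mul_comm, h x hx]⟩

theorem zdSet_eq_map (hB : IsContentAlgebra R B) (hA : PropertyA R) {Z : Ideal R}
    (hZ : (Z : Set R) = zdSet R) :
    zdSet B = (Z.map (algebraMap R B) : Set B) := by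
  have hmem (f : B) : f ∈ Z.map (algebraMap R B) ↔ f ∈ Z • (⊤ : Submodule R B) := by
    rw [Ideal.smul_top_eq_map, Submodule.restrictScalars_mem]
  ext f
  rw [SetLike.mem_coe, hmem]
  refine ⟨fun hf => ?_, fun hf => ?_⟩
  · have hle : contentIdeal R f ≤ Z :=
      SetLike.coe_subset_coe.1 (hZ ▸ hB.contentIdeal_subset_zdSet hf)
    exact Submodule.smul_mono_left hle (hB.mem_content_smul f)
  · obtain ⟨r, hr, h⟩ := hA _ (hB.contentIdeal_fg f)
      (hZ ▸ SetLike.coe_subset_coe.2 (contentIdeal_le hf))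
    exact ⟨_, hB.algebraMap_ne_zero hr, by rw [mul_comm, hB.algebraMap_mul_eq_zero h]⟩

theorem propertyA (hB : IsContentAlgebra R B) (hprimal : PrimalRing R) (hA : PropertyA R) :
    PropertyA B := by
  obtain ⟨Z, hZ⟩ := hprimal
  rintro _ ⟨s, rfl⟩ hs
  have hle : s.sup (contentIdeal R) ≤ Z := Finset.sup_le fun f hf =>
    SetLike.coe_subset_coe.1 (hZ ▸ hB.contentIdeal_subset_zdSet (hs (Submodule.subset_span hf)))
  obtain ⟨r, hr, h⟩ := hA _ (Submodule.fg_finset_sup s _ fun f _ => hB.contentIdeal_fg f)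
    (hZ ▸ SetLike.coe_subset_coe.2 hle)
  refine ⟨algebraMap R B r, hB.algebraMap_ne_zero hr, fun x hx => ?_⟩
  induction hx using Submodule.span_induction with
  | mem f hf =>
    exact hB.algebraMap_mul_eq_zero fun x hx =>
      h x (Finset.le_sup (f := contentIdeal R) hf hx)
  | zero => exact mul_zero _
  | add x y _ _ hx hy => rw [mul_add, hx, hy, add_zero]
  | smul b x _ hx => rw [smul_eq_mul, mul_left_comm, hx, mul_zero]

end IsContentAlgebra

end Content

/-- If `R` is a primal ring with Property (A) and `B` is a content `R`-algebra, then `B`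
is primal, `B` has Property (A), and `Z(B) = Z(R)B`. -/
theorem primal_propertyA_of_isContentAlgebra
    (R B : Type*) [CommRing R] [CommRing B] [Algebra R B]
    (hB : IsContentAlgebra R B) (hprimal : PrimalRing R) (hA : PropertyA R) :
    PrimalRing B ∧ PropertyA B ∧
      zdSet B = (Ideal.span (algebraMap R B '' zdSet R) : Set B) := by
  refine ⟨?_, hB.propertyA hprimal hA, ?_⟩ <;> obtain ⟨Z, hZ⟩ := hprimal
  · exact ⟨_, (hB.zdSet_eq_map hA hZ).symm⟩
  · rw [← hZ]
    exact hB.zdSet_eq_map hA hZ
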